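/- arXiv:2209.13788 — 7 statements merged into one kernel-verified Lean document; each statement's English description precedes it below -/
import Mathlib

section
/- Let B ∈ ℝ^((q−m−r)×q) and suppose that A, M and B each have full row rank, that the row spaces R(Aᵀ), R(Mᵀ) and R(Bᵀ) are pairwise orthogonal, and that Ad = b. Then (M Mᵀ is invertible and) ΘP = {v ∈ ℝ^r : there exists t ∈ ℝ^(q−m−r) such that d + Mᵀ(M Mᵀ)⁻¹ v − Bᵀ t ∈ K}. -/
open Matrix Set Topology Filter

noncomputable section

variable {q m r : ℕ}

/-- The dual cone `K* = {y : ⟨y,x⟩ ≥ 0 for all x ∈ K}`. -/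
def dualCone (K : Set (Fin q → ℝ)) : Set (Fin q → ℝ) :=
  {y | ∀ x ∈ K, 0 ≤ y ⬝ᵥ x}

/-- `K` is a pointed, closed, convex cone with nonempty interior. -/
def ConeAssumptions (K : Set (Fin q → ℝ)) : Prop :=
  IsClosed K ∧ Convex ℝ K ∧ (∀ x ∈ K, ∀ t : ℝ, 0 < t → t • x ∈ K) ∧
    (∀ x ∈ K, x ≠ 0 → -x ∉ K) ∧ (interior K).Nonempty

/-- The mpKKT system for parameters `(u,v)` with data `(x,w,y)`. -/
def mpKKT (K : Set (Fin q → ℝ)) (A : Matrix (Fin m) (Fin q) ℝ)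
    (M : Matrix (Fin r) (Fin q) ℝ) (b : Fin m → ℝ) (c d : Fin q → ℝ)
    (u v : Fin r → ℝ) (x : Fin q → ℝ) (w : Fin m → ℝ) (y : Fin q → ℝ) : Prop :=
  A.mulVec x = b ∧ M.mulVec x = M.mulVec d + v ∧ x ∈ K ∧
    Aᵀ.mulVec w + y = c + Mᵀ.mulVec u ∧ y ∈ dualCone K ∧ x ⬝ᵥ y = 0

/-- The set-valued map `Φ`. -/
def Phi (K : Set (Fin q → ℝ)) (A : Matrix (Fin m) (Fin q) ℝ)
    (M : Matrix (Fin r) (Fin q) ℝ) (b : Fin m → ℝ) (c d : Fin q → ℝ)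
    (u : Fin r → ℝ) : Set (Fin r → ℝ) :=
  {v | ∃ x w y, mpKKT K A M b c d u v x w y}

/-- The set-valued map `Ψ`. -/
def Psi (K : Set (Fin q → ℝ)) (A : Matrix (Fin m) (Fin q) ℝ)
    (M : Matrix (Fin r) (Fin q) ℝ) (b : Fin m → ℝ) (c d : Fin q → ℝ)
    (v : Fin r → ℝ) : Set (Fin r → ℝ) :=
  {u | ∃ x w y, mpKKT K A M b c d u v x w y}

/-- The primal conic representable set `ΘP`. -/
def ThetaP (K : Set (Fin q → ℝ)) (A : Matrix (Fin m) (Fin q) ℝ)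
    (M : Matrix (Fin r) (Fin q) ℝ) (b : Fin m → ℝ) (d : Fin q → ℝ) :
    Set (Fin r → ℝ) :=
  {v | ∃ x ∈ K, A.mulVec x = b ∧ M.mulVec x = M.mulVec d + v}

/-- The dual conic representable set `ΘD`. -/
def ThetaD (K : Set (Fin q → ℝ)) (A : Matrix (Fin m) (Fin q) ℝ)
    (M : Matrix (Fin r) (Fin q) ℝ) (c : Fin q → ℝ) : Set (Fin r → ℝ) :=
  {u | ∃ w : Fin m → ℝ, ∃ y ∈ dualCone K, Aᵀ.mulVec w + y = c + Mᵀ.mulVec u}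

/-- Assumption 1: full row rank and trivially intersecting row spaces. -/
def Assumption1 (A : Matrix (Fin m) (Fin q) ℝ) (M : Matrix (Fin r) (Fin q) ℝ) : Prop :=
  LinearIndependent ℝ A ∧ LinearIndependent ℝ M ∧
    Submodule.span ℝ (Set.range A) ⊓ Submodule.span ℝ (Set.range M) = ⊥

/-- Assumption 2 (Slater condition). -/
def Assumption2 (K : Set (Fin q → ℝ)) (A : Matrix (Fin m) (Fin q) ℝ)
    (M : Matrix (Fin r) (Fin q) ℝ) (b : Fin m → ℝ) (c : Fin q → ℝ) : Prop :=
  (∃ x ∈ interior K, A.mulVec x = b) ∧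
    ∃ (w : Fin m → ℝ) (s : Fin r → ℝ),
      c - Aᵀ.mulVec w - Mᵀ.mulVec s ∈ interior (dualCone K)

/-- A basic semialgebraic set: finitely many polynomial equalities and strict inequalities. -/
def IsBasicSemialgebraic {ι : Type} [Fintype ι] (S : Set (ι → ℝ)) : Prop :=
  ∃ (k l : ℕ) (f : Fin k → MvPolynomial ι ℝ) (g : Fin l → MvPolynomial ι ℝ),
    S = {x | (∀ i, MvPolynomial.eval x (f i) = 0) ∧ ∀ j, 0 < MvPolynomial.eval x (g j)}

/-- A semialgebraic set: a finite union of basic semialgebraic sets. -/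
def IsSemialgebraic {ι : Type} [Fintype ι] (S : Set (ι → ℝ)) : Prop :=
  ∃ (N : ℕ) (T : Fin N → Set (ι → ℝ)), (∀ i, IsBasicSemialgebraic (T i)) ∧ S = ⋃ i, T i

/-- A linearity set of `ΘP`. -/
def IsLinearitySet (K : Set (Fin q → ℝ)) (A : Matrix (Fin m) (Fin q) ℝ)
    (M : Matrix (Fin r) (Fin q) ℝ) (b : Fin m → ℝ) (c d : Fin q → ℝ)
    (V : Set (Fin r → ℝ)) : Prop :=
  V ⊆ ThetaP K A M b d ∧ IsPathConnected V ∧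
    (∀ v₁ ∈ V, ∀ v₂ ∈ V, Psi K A M b c d v₁ = Psi K A M b c d v₂) ∧
    (∀ v ∈ V, (Psi K A M b c d v).Nonempty) ∧
    (∃ v ∈ V, ∃ u ∈ Psi K A M b c d v, ∃ v' : Fin r → ℝ, v' ≠ v ∧ u ∈ Psi K A M b c d v') ∧
    ∀ G : Set (Fin r → ℝ), G ⊆ ThetaP K A M b d → IsPathConnected G → V ⊂ G →
      ¬((∀ v₁ ∈ G, ∀ v₂ ∈ G, Psi K A M b c d v₁ = Psi K A M b c d v₂) ∧
        ∀ v ∈ G, (Psi K A M b c d v).Nonempty)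

/-- A nonlinearity set of `ΘP`: a maximal path-connected open subset of `ΘP`
disjoint from every linearity set. -/
def IsNonlinearitySet (K : Set (Fin q → ℝ)) (A : Matrix (Fin m) (Fin q) ℝ)
    (M : Matrix (Fin r) (Fin q) ℝ) (b : Fin m → ℝ) (c d : Fin q → ℝ)
    (V : Set (Fin r → ℝ)) : Prop :=
  V ⊆ ThetaP K A M b d ∧ IsPathConnected V ∧ IsOpen V ∧
    (∀ L, IsLinearitySet K A M b c d L → Disjoint V L) ∧
    ∀ G : Set (Fin r → ℝ), G ⊆ ThetaP K A M b d → IsPathConnected G → IsOpen G →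
      (∀ L, IsLinearitySet K A M b c d L → Disjoint G L) → V ⊆ G → G = V

/-- The set of optimal solutions of the primal problem with objective `⟨c + Mᵀu, ·⟩`. -/
def Xstar (K : Set (Fin q → ℝ)) (A : Matrix (Fin m) (Fin q) ℝ)
    (M : Matrix (Fin r) (Fin q) ℝ) (b : Fin m → ℝ) (c : Fin q → ℝ)
    (u : Fin r → ℝ) : Set (Fin q → ℝ) :=
  {x | x ∈ K ∧ A.mulVec x = b ∧
    ∀ x' ∈ K, A.mulVec x' = b → (c + Mᵀ.mulVec u) ⬝ᵥ x ≤ (c + Mᵀ.mulVec u) ⬝ᵥ x'}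

/-- The set of optimal solutions `(w,y)` of the dual problem. -/
def Ystar (K : Set (Fin q → ℝ)) (A : Matrix (Fin m) (Fin q) ℝ)
    (M : Matrix (Fin r) (Fin q) ℝ) (b : Fin m → ℝ) (c : Fin q → ℝ)
    (u : Fin r → ℝ) : Set ((Fin m → ℝ) × (Fin q → ℝ)) :=
  {p | Aᵀ.mulVec p.1 + p.2 = c + Mᵀ.mulVec u ∧ p.2 ∈ dualCone K ∧
    ∀ (w' : Fin m → ℝ) (y' : Fin q → ℝ),
      Aᵀ.mulVec w' + y' = c + Mᵀ.mulVec u → y' ∈ dualCone K → b ⬝ᵥ w' ≤ b ⬝ᵥ p.1}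

/-- The optimal value function of the primal problem (1). -/
def valP (K : Set (Fin q → ℝ)) (A : Matrix (Fin m) (Fin q) ℝ)
    (M : Matrix (Fin r) (Fin q) ℝ) (b : Fin m → ℝ) (c d : Fin q → ℝ)
    (v : Fin r → ℝ) : ℝ :=
  sInf {z | ∃ x ∈ K, A.mulVec x = b ∧ M.mulVec x = M.mulVec d + v ∧ z = c ⬝ᵥ x}

lemma aux_gram {n : ℕ} (A : Matrix (Fin n) (Fin q) ℝ) (hA : LinearIndependent ℝ A)
    (w : Fin n → ℝ) (h : A.mulVec (Aᵀ.mulVec w) = 0) : w = 0 := by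
  have h1 : Aᵀ.mulVec w = 0 := by
    have : (Aᵀ.mulVec w) ⬝ᵥ (Aᵀ.mulVec w) = 0 := by
      rw [Matrix.dotProduct_mulVec, Matrix.vecMul_transpose, h, zero_dotProduct]
    exact dotProduct_self_eq_zero.mp this
  have h2 : Function.Injective A.vecMul := Matrix.vecMul_injective_iff.mpr hA
  apply h2
  show w ᵥ* A = 0 ᵥ* A
  rw [← Matrix.mulVec_transpose, h1]
  simp

lemma aux_orth {n k : ℕ} (A : Matrix (Fin n) (Fin q) ℝ) (B : Matrix (Fin k) (Fin q) ℝ)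
    (h : ∀ i j, A i ⬝ᵥ B j = 0) (t : Fin k → ℝ) : A.mulVec (Bᵀ.mulVec t) = 0 := by
  have : A * Bᵀ = 0 := by
    ext i j
    exact h i j
  rw [Matrix.mulVec_mulVec, this, Matrix.zero_mulVec]

lemma aux_orth' {n k : ℕ} (A : Matrix (Fin n) (Fin q) ℝ) (B : Matrix (Fin k) (Fin q) ℝ)
    (h : ∀ i j, A i ⬝ᵥ B j = 0) (t : Fin n → ℝ) : B.mulVec (Aᵀ.mulVec t) = 0 :=
  aux_orth B A (fun i j => by rw [dotProduct_comm]; exact h j i) t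

lemma aux_ker (hmr : m + r ≤ q)
    (A : Matrix (Fin m) (Fin q) ℝ) (M : Matrix (Fin r) (Fin q) ℝ)
    (B : Matrix (Fin (q - m - r)) (Fin q) ℝ)
    (hA : LinearIndependent ℝ A) (hM : LinearIndependent ℝ M)
    (hB : LinearIndependent ℝ B)
    (hAM : ∀ i j, A i ⬝ᵥ M j = 0) (hAB : ∀ i j, A i ⬝ᵥ B j = 0)
    (hMB : ∀ i j, M i ⬝ᵥ B j = 0) (z : Fin q → ℝ) (hz : A.mulVec z = 0)
    (hz' : M.mulVec z = 0) : ∃ t, z = Bᵀ.mulVec t := by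
  let L : ((Fin m → ℝ) × (Fin r → ℝ) × (Fin (q - m - r) → ℝ)) →ₗ[ℝ] (Fin q → ℝ) :=
    (Aᵀ.mulVecLin).coprod ((Mᵀ.mulVecLin).coprod (Bᵀ.mulVecLin))
  have hL : ∀ w s t, L (w, s, t) = Aᵀ.mulVec w + (Mᵀ.mulVec s + Bᵀ.mulVec t) := by
    intro w s t
    rfl
  have key : ∀ w s t, A.mulVec (L (w, s, t)) = 0 → M.mulVec (L (w, s, t)) = 0 →
      w = 0 ∧ s = 0 := by
    intro w s t h1 h2
    rw [hL] at h1 h2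
    simp only [Matrix.mulVec_add, aux_orth A M hAM, aux_orth A B hAB, aux_orth M B hMB,
      aux_orth' A M hAM, add_zero, zero_add] at h1 h2
    exact ⟨aux_gram A hA w h1, aux_gram M hM s h2⟩
  have hinj : Function.Injective L := by
    rw [injective_iff_map_eq_zero]
    rintro ⟨w, s, t⟩ h
    obtain ⟨rfl, rfl⟩ := key w s t (by rw [h, Matrix.mulVec_zero]) (by rw [h, Matrix.mulVec_zero])
    rw [hL] at h
    simp only [Matrix.mulVec_zero, zero_add] at h
    have : t = 0 := aux_gram B hB t (by rw [h, Matrix.mulVec_zero])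
    rw [this]
    rfl
  have hsurj : Function.Surjective L := by
    refine (LinearMap.injective_iff_surjective_of_finrank_eq_finrank ?_).mp hinj
    simp
    omega
  obtain ⟨⟨w, s, t⟩, rfl⟩ := hsurj z
  obtain ⟨rfl, rfl⟩ := key w s t hz hz'
  exact ⟨t, by rw [hL]; simp⟩

/-- Representation of `ΘP` as a conic representable set. -/
theorem stmt_0 (hq : 0 < q) (hm : 0 < m) (hr : 0 < r) (hmr : m + r ≤ q)
    (K : Set (Fin q → ℝ)) (hK : ConeAssumptions K)
    (A : Matrix (Fin m) (Fin q) ℝ) (M : Matrix (Fin r) (Fin q) ℝ)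
    (B : Matrix (Fin (q - m - r)) (Fin q) ℝ)
    (b : Fin m → ℝ) (c d : Fin q → ℝ)
    (hA : LinearIndependent ℝ A) (hM : LinearIndependent ℝ M)
    (hB : LinearIndependent ℝ B)
    (hAM : ∀ i j, A i ⬝ᵥ M j = 0) (hAB : ∀ i j, A i ⬝ᵥ B j = 0)
    (hMB : ∀ i j, M i ⬝ᵥ B j = 0)
    (hAd : A.mulVec d = b) :
    IsUnit (M * Mᵀ) ∧
      ThetaP K A M b d =
        {v | ∃ t : Fin (q - m - r) → ℝ,
          d + Mᵀ.mulVec ((M * Mᵀ)⁻¹.mulVec v) - Bᵀ.mulVec t ∈ K} := by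
  have hU : IsUnit (M * Mᵀ) := by
    rw [← Matrix.mulVec_injective_iff_isUnit]
    intro x y hxy
    have : M.mulVec (Mᵀ.mulVec (x - y)) = 0 := by
      rw [Matrix.mulVec_mulVec, Matrix.mulVec_sub]
      exact sub_eq_zero.mpr hxy
    exact sub_eq_zero.mp (aux_gram M hM _ this)
  have hinv : ∀ v, M.mulVec (Mᵀ.mulVec ((M * Mᵀ)⁻¹.mulVec v)) = v := by
    intro v
    rw [Matrix.mulVec_mulVec, Matrix.mulVec_mulVec,
      Matrix.mul_nonsing_inv _ ((Matrix.isUnit_iff_isUnit_det _).mp hU), Matrix.one_mulVec]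
  refine ⟨hU, ?_⟩
  ext v
  constructor
  · rintro ⟨x, hx, hx1, hx2⟩
    obtain ⟨t, ht⟩ := aux_ker hmr A M B hA hM hB hAM hAB hMB
      (d + Mᵀ.mulVec ((M * Mᵀ)⁻¹.mulVec v) - x)
      (by rw [Matrix.mulVec_sub, Matrix.mulVec_add, aux_orth A M hAM, hx1, hAd]; simp)
      (by rw [Matrix.mulVec_sub, Matrix.mulVec_add, hinv, hx2]; simp)
    refine ⟨t, ?_⟩
    rw [← ht, sub_sub_cancel]
    exact hx
  · rintro ⟨t, ht⟩
    refine ⟨_, ht, ?_, ?_⟩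
    · rw [Matrix.mulVec_sub, Matrix.mulVec_add, aux_orth A M hAM, aux_orth A B hAB, hAd]; simp
    · rw [Matrix.mulVec_sub, Matrix.mulVec_add, hinv, aux_orth M B hMB]; simp
end
end

section
/- Under Assumptions 1 and 2, for every u in the interior of ΘD there exists v ∈ ΘP with v ∈ Φ(u); that is, there exist v ∈ ℝ^r and a triple (x, w, y) solving the mpKKT system for (u, v). -/
open Matrix Set Topology Filter

noncomputable section

variable {q m r : ℕ}

lemma dual_coercive (K : Set (Fin q → ℝ)) (y : Fin q → ℝ) (hy : y ∈ interior (dualCone K)) :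
    ∃ δ : ℝ, 0 < δ ∧ ∀ x ∈ K, δ * ‖x‖ ≤ y ⬝ᵥ x := by
  obtain ⟨ε, hε, hb⟩ := Metric.isOpen_iff.1 isOpen_interior y hy
  refine ⟨ε / 2, by positivity, fun x hx => ?_⟩
  have key : ∀ i, ∀ t : ℝ, |t| = ε / 2 → 0 ≤ y ⬝ᵥ x + t * x i := by
    intro i t ht
    have h1 : y + Pi.single i t ∈ dualCone K := by
      apply interior_subset
      apply hb
      rw [Metric.mem_ball, dist_eq_norm, add_sub_cancel_left, Pi.norm_single, Real.norm_eq_abs, ht]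
      linarith
    have h2 := h1 x hx
    rwa [add_dotProduct, single_dotProduct] at h2
  have hc : ∀ i, |x i| ≤ (y ⬝ᵥ x) / (ε / 2) := by
    intro i
    rw [le_div_iff₀ (by positivity)]
    have h1 := key i (ε / 2) (abs_of_pos (by positivity))
    have h2 := key i (-(ε / 2)) (by rw [abs_neg]; exact abs_of_pos (by positivity))
    rcases abs_cases (x i) with h | h <;> rw [h.1] <;> nlinarith
  have h0 : 0 ≤ y ⬝ᵥ x := interior_subset hy x hx
  have := (pi_norm_le_iff_of_nonneg (x := x) (r := (y ⬝ᵥ x) / (ε / 2)) (by positivity)).2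
    (fun i => hc i)
  rw [le_div_iff₀ (by positivity)] at this
  linarith

lemma mulVec_surj (A : Matrix (Fin m) (Fin q) ℝ) (hA : LinearIndependent ℝ A) :
    Function.Surjective A.mulVecLin := by
  rw [← LinearMap.range_eq_top]
  apply Submodule.eq_top_of_finrank_eq
  have := LinearIndependent.rank_matrix (M := A) hA
  rw [Matrix.rank] at this
  rw [this]; simp

lemma multiplier (K : Set (Fin q → ℝ)) (hK : ConeAssumptions K)
    (A : Matrix (Fin m) (Fin q) ℝ) (hA : LinearIndependent ℝ A) (b : Fin m → ℝ)
    (y : Fin q → ℝ) (xh : Fin q → ℝ) (hxh : xh ∈ interior K) (hxb : A.mulVec xh = b)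
    (xs : Fin q → ℝ) (hxs : xs ∈ K) (hxsb : A.mulVec xs = b)
    (hmin : ∀ x ∈ K, A.mulVec x = b → y ⬝ᵥ xs ≤ y ⬝ᵥ x) :
    ∃ w : Fin m → ℝ, y - Aᵀ.mulVec w ∈ dualCone K ∧ (y - Aᵀ.mulVec w) ⬝ᵥ xs = 0 := by
  obtain ⟨hcl, hconv, hcone, -, hne⟩ := hK
  let U : Set ((Fin q → ℝ) × ℝ) := {p | p.1 ∈ interior K ∧ y ⬝ᵥ p.1 < p.2}
  have hcont : Continuous fun x : Fin q → ℝ => y ⬝ᵥ x := by fun_prop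
  have hUo : IsOpen U :=
    (isOpen_interior.preimage continuous_fst).inter
      (isOpen_lt (hcont.comp continuous_fst) continuous_snd)
  have hUc : Convex ℝ U := by
    rintro p ⟨hp1, hp2⟩ p' ⟨hp1', hp2'⟩ α β hα hβ hαβ
    refine ⟨hconv.interior hp1 hp1' hα hβ hαβ, ?_⟩
    simp only [Prod.fst_add, Prod.smul_fst, Prod.snd_add, Prod.smul_snd, dotProduct_add,
      dotProduct_smul, smul_eq_mul]
    rcases hα.eq_or_lt with h | h
    · have : β = 1 := by linarith
      subst h; subst this; linarith
    · nlinarith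
  let T : ((Fin q → ℝ) × ℝ) →ₗ[ℝ] ((Fin m → ℝ) × ℝ) := A.mulVecLin.prodMap LinearMap.id
  have hT : Function.Surjective T := by
    rintro ⟨a, s⟩
    obtain ⟨x, hx⟩ := mulVec_surj A hA a
    exact ⟨(x, s), by simp only [T, LinearMap.prodMap_apply, hx, LinearMap.id_apply]⟩
  have hTo : IsOpenMap T := by
    exact LinearMap.isOpenMap_of_finiteDimensional T hT
  have hnot : (b, y ⬝ᵥ xs) ∉ T '' U := by
    rintro ⟨⟨x, s⟩, ⟨h1, h2⟩, h3⟩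
    simp only [T, LinearMap.prodMap_apply, LinearMap.id_apply, Prod.mk.injEq,
      Matrix.mulVecLin_apply] at h3 h2
    have := hmin x (interior_subset h1) h3.1
    linarith [h3.2]
  obtain ⟨f, hf⟩ := geometric_hahn_banach_point_open (hUc.linear_image T) (hTo _ hUo) hnot
  let g : (Fin m → ℝ) →ₗ[ℝ] ℝ := f.toLinearMap ∘ₗ LinearMap.inl ℝ _ _
  obtain ⟨w, hw⟩ := (dotProductEquiv ℝ (Fin m)).surjective g
  set lam := f (0, 1) with hlam
  have hfe : ∀ a s, f (a, s) = w ⬝ᵥ a + s * lam := by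
    intro a s
    have h1 : ((a, s) : (Fin m → ℝ) × ℝ) = (a, 0) + s • (0, 1) := by simp
    have h2 : g a = w ⬝ᵥ a := by rw [← hw]; rfl
    rw [h1, map_add, map_smul, ← h2]; rfl
  have hf2 : ∀ x ∈ interior K, ∀ s, y ⬝ᵥ x < s →
      w ⬝ᵥ b + (y ⬝ᵥ xs) * lam < w ⬝ᵥ (A.mulVec x) + s * lam := by
    intro x hx s hs
    have := hf (A.mulVec x, s) ⟨(x, s), ⟨hx, hs⟩, rfl⟩
    rwa [hfe, hfe] at this
  have hxx := hmin xh (interior_subset hxh) hxb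
  have hlpos : 0 < lam := by
    have := hf2 xh hxh (y ⬝ᵥ xh + 1) (by linarith)
    rw [hxb] at this
    by_contra hn
    nlinarith
  have hint : ∀ x ∈ interior K,
      w ⬝ᵥ b + (y ⬝ᵥ xs) * lam ≤ w ⬝ᵥ (A.mulVec x) + (y ⬝ᵥ x) * lam := by
    intro x hx
    apply le_of_forall_pos_le_add
    intro ε hε
    have := hf2 x hx (y ⬝ᵥ x + ε / lam) (by have := div_pos hε hlpos; linarith)
    rw [add_mul, div_mul_cancel₀ _ hlpos.ne'] at this
    linarith
  have hall : ∀ x ∈ K,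
      w ⬝ᵥ b + (y ⬝ᵥ xs) * lam ≤ w ⬝ᵥ (A.mulVec x) + (y ⬝ᵥ x) * lam := by
    intro x hx
    have hx' : x ∈ closure (interior K) := by
      rw [hconv.closure_interior_eq_closure_of_nonempty_interior hne]; exact subset_closure hx
    have hc : IsClosed {x : Fin q → ℝ |
        w ⬝ᵥ b + (y ⬝ᵥ xs) * lam ≤ w ⬝ᵥ (A.mulVec x) + (y ⬝ᵥ x) * lam} := by
      apply isClosed_le <;> fun_prop
    exact closure_minimal hint hc hx'
  have hz : ∀ x, (y - Aᵀ.mulVec (-(lam⁻¹ • w))) ⬝ᵥ x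
      = lam⁻¹ * (w ⬝ᵥ (A.mulVec x) + (y ⬝ᵥ x) * lam) := by
    intro x
    rw [Matrix.mulVec_neg, sub_neg_eq_add, Matrix.mulVec_smul, add_dotProduct, smul_dotProduct,
      Matrix.mulVec_transpose, ← Matrix.dotProduct_mulVec, smul_eq_mul]
    field_simp
    ring
  have hC : ∀ x ∈ K, 0 ≤ w ⬝ᵥ (A.mulVec x) + (y ⬝ᵥ x) * lam := by
    intro x hx
    by_contra hn
    push Not at hn
    set h := w ⬝ᵥ (A.mulVec x) + (y ⬝ᵥ x) * lam with hh
    set C := w ⬝ᵥ b + (y ⬝ᵥ xs) * lam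
    have ht : 0 < (|C| + 1) / (-h) := div_pos (by positivity) (by linarith)
    have := hall _ (hcone x hx _ ht)
    rw [Matrix.mulVec_smul, dotProduct_smul, dotProduct_smul, smul_eq_mul, smul_eq_mul,
      mul_assoc, ← mul_add, ← hh] at this
    have e : (|C| + 1) / (-h) * h = -(|C| + 1) := by
      have : h ≠ 0 := hn.ne
      field_simp
    rw [e] at this
    have := neg_abs_le C
    linarith
  refine ⟨-(lam⁻¹ • w), ?_, ?_⟩
  · intro x hx
    rw [hz]
    exact mul_nonneg (inv_nonneg.2 hlpos.le) (hC x hx)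
  · rw [hz]
    have h1 := hC xs hxs
    have h2 := hall _ (hcone xs hxs (1/2) (by norm_num))
    rw [Matrix.mulVec_smul, dotProduct_smul, dotProduct_smul, smul_eq_mul, smul_eq_mul, hxsb] at h2
    rw [hxsb] at h1 ⊢
    have : w ⬝ᵥ b + y ⬝ᵥ xs * lam = 0 := by linarith
    rw [this, mul_zero]

/-- under the Slater type condition, `Φ(u)` is well defined on `int ΘD`. -/
theorem stmt_4 (hq : 0 < q) (hm : 0 < m) (hr : 0 < r) (hmr : m + r ≤ q)
    (K : Set (Fin q → ℝ)) (hK : ConeAssumptions K)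
    (A : Matrix (Fin m) (Fin q) ℝ) (M : Matrix (Fin r) (Fin q) ℝ)
    (b : Fin m → ℝ) (c d : Fin q → ℝ)
    (hA1 : Assumption1 A M) (hA2 : Assumption2 K A M b c) :
    ∀ u ∈ interior (ThetaD K A M c),
      ∃ v ∈ ThetaP K A M b d, v ∈ Phi K A M b c d u := by
  intro u hu
  obtain ⟨⟨xh, hxh, hxb⟩, w1, s, hs⟩ := hA2
  set y1 := c - Aᵀ.mulVec w1 - Mᵀ.mulVec s with hy1
  obtain ⟨δ, hδ, hco⟩ := dual_coercive K y1 hs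
  -- extend beyond `u`
  have hlim : Tendsto (fun t : ℝ => u + t • (u + s)) (𝓝[>] 0) (𝓝 u) := by
    have : Continuous fun t : ℝ => u + t • (u + s) := by fun_prop
    have h := this.tendsto 0
    simp only [zero_smul, add_zero] at h
    exact h.mono_left nhdsWithin_le_nhds
  obtain ⟨t, htm, ht⟩ := ((hlim.eventually (isOpen_interior.mem_nhds hu)).and
    self_mem_nhdsWithin).exists
  have ht : 0 < t := ht
  obtain ⟨w2, y2, hy2, he2⟩ := interior_subset htm
  set a := (1 + t)⁻¹ with ha
  have hapos : 0 < a := by positivity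
  have hat : a * (1 + t) = 1 := inv_mul_cancel₀ (by positivity)
  set y0 := a • y2 + (a * t) • y1 with hy0
  set w0 := a • w2 + (a * t) • w1 with hw0
  have he0 : Aᵀ.mulVec w0 + y0 = c + Mᵀ.mulVec u := by
    have e2 : y2 = c + Mᵀ.mulVec (u + t • (u + s)) - Aᵀ.mulVec w2 := by rw [← he2]; abel
    rw [hw0, hy0, e2, hy1]
    simp only [Matrix.mulVec_add, Matrix.mulVec_smul]
    ext i
    simp only [Pi.add_apply, Pi.smul_apply, Pi.sub_apply, smul_eq_mul]
    linear_combination (c i + (Mᵀ *ᵥ u) i) * hat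
  have hco0 : ∀ x ∈ K, (a * t * δ) * ‖x‖ ≤ y0 ⬝ᵥ x := by
    intro x hx
    rw [hy0, add_dotProduct, smul_dotProduct, smul_dotProduct, smul_eq_mul, smul_eq_mul]
    have h1 := mul_nonneg hapos.le (hy2 x hx)
    have h2 := mul_le_mul_of_nonneg_left (hco x hx) (mul_pos hapos ht).le
    linarith
  have hD : 0 < a * t * δ := by positivity
  have hcpt : IsCompact (K ∩ {x | A.mulVec x = b} ∩ {x | y0 ⬝ᵥ x ≤ y0 ⬝ᵥ xh}) := by
    apply Metric.isCompact_of_isClosed_isBounded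
    · refine (hK.1.inter ?_).inter ?_
      · apply isClosed_eq <;> fun_prop
      · apply isClosed_le <;> fun_prop
    · rw [isBounded_iff_forall_norm_le]
      refine ⟨(y0 ⬝ᵥ xh) / (a * t * δ), fun x hx => ?_⟩
      rw [le_div_iff₀ hD]
      have := hco0 x hx.1.1
      have h2 : y0 ⬝ᵥ x ≤ y0 ⬝ᵥ xh := hx.2
      linarith
  obtain ⟨xs, ⟨⟨hxsK, hxsb⟩, hxsle⟩, hxsmin⟩ := hcpt.exists_isMinOn
    ⟨xh, ⟨interior_subset hxh, hxb⟩, le_refl (y0 ⬝ᵥ xh)⟩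
    (f := fun x => y0 ⬝ᵥ x) (by fun_prop)
  have hxsb : A.mulVec xs = b := hxsb
  have hmin : ∀ x ∈ K, A.mulVec x = b → y0 ⬝ᵥ xs ≤ y0 ⬝ᵥ x := by
    intro x hx hxA
    by_cases h : y0 ⬝ᵥ x ≤ y0 ⬝ᵥ xh
    · exact hxsmin ⟨⟨hx, hxA⟩, h⟩
    · have h2 : y0 ⬝ᵥ xs ≤ y0 ⬝ᵥ xh := hxsle
      linarith
  obtain ⟨w, hwK, hw0'⟩ := multiplier K hK A hA1.1 b y0 xh hxh hxb xs hxsK hxsb hmin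
  refine ⟨M.mulVec xs - M.mulVec d, ⟨xs, hxsK, hxsb, by abel⟩, xs, w0 + w, y0 - Aᵀ.mulVec w,
    hxsb, by abel, hxsK, ?_, hwK, ?_⟩
  · rw [← he0, Matrix.mulVec_add]; abel
  · rw [dotProduct_comm]; exact hw0'
end
end

section
/- Under Assumptions 1 and 2, for every u ∈ ℝ^r the set Φ(u) is convex and closed, and for every v ∈ ℝ^r the set Ψ(v) is convex and closed. -/
open Matrix Set Topology Filter

noncomputable section

variable {q m r : ℕ}

theorem aux_closed {P Z : Type*} [NormedAddCommGroup P] [NormedAddCommGroup Z] [ProperSpace Z]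
    (Q : Set (P × Z)) (hQ : IsClosed Q) (g : P → ℝ) (hg : Continuous g)
    (hb : ∀ p z, (p, z) ∈ Q → ‖z‖ ≤ g p) : IsClosed {p | ∃ z, (p, z) ∈ Q} := by
  apply IsSeqClosed.isClosed
  intro p p0 hp hlim
  choose z hz using hp
  have h1 : Tendsto (fun n => g (p n)) atTop (𝓝 (g p0)) := (hg.tendsto p0).comp hlim
  obtain ⟨B, hB⟩ := h1.bddAbove_range
  have h2 : ∀ n, z n ∈ Metric.closedBall (0 : Z) B := by
    intro n
    rw [mem_closedBall_zero_iff]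
    exact (hb _ _ (hz n)).trans (hB ⟨n, rfl⟩)
  obtain ⟨z0, -, φ, hφ, hz0⟩ := tendsto_subseq_of_bounded Metric.isBounded_closedBall h2
  refine ⟨z0, ?_⟩
  have h3 : Tendsto (fun n => (p (φ n), z (φ n))) atTop (𝓝 (p0, z0)) :=
    (hlim.comp hφ.tendsto_atTop).prodMk_nhds hz0
  exact hQ.mem_of_tendsto h3 (Eventually.of_forall fun n => hz (φ n))

theorem aux_slater {q : ℕ} (C : Set (Fin q → ℝ)) (z : Fin q → ℝ) (hz : z ∈ interior C) :
    ∃ B : ℝ, ∀ y : Fin q → ℝ, (∀ x ∈ C, 0 ≤ y ⬝ᵥ x) → ‖y‖ ≤ B * (y ⬝ᵥ z) := by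
  obtain ⟨t, ht, hball⟩ := Metric.isOpen_iff.1 isOpen_interior z hz
  refine ⟨(t / 2)⁻¹, fun y hy => ?_⟩
  have hzz : 0 ≤ y ⬝ᵥ z := hy z (interior_subset hz)
  have key : ∀ (i : Fin q) (s : ℝ), |s| < t → 0 ≤ y ⬝ᵥ z + y i * s := by
    intro i s hs
    have : z + Pi.single i s ∈ C := by
      apply interior_subset
      apply hball
      rw [Metric.mem_ball, dist_eq_norm, add_sub_cancel_left, Pi.norm_single]
      exact hs
    have h := hy _ this
    rwa [dotProduct_add, dotProduct_single] at h
  rw [pi_norm_le_iff_of_nonneg (by positivity)]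
  intro i
  rw [Real.norm_eq_abs, inv_mul_eq_div, le_div_iff₀ (by positivity)]
  have h1 := key i (t / 2) (by rw [abs_of_pos (by positivity)]; linarith)
  have h2 := key i (-(t / 2)) (by rw [abs_neg, abs_of_pos (by positivity)]; linarith)
  rcases abs_cases (y i) with ⟨h, _⟩ | ⟨h, _⟩ <;> rw [h] <;> linarith

theorem aux_adj {m q : ℕ} (A : Matrix (Fin m) (Fin q) ℝ) (w : Fin m → ℝ) (x : Fin q → ℝ) :
    x ⬝ᵥ (Aᵀ *ᵥ w) = (A *ᵥ x) ⬝ᵥ w := by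
  rw [dotProduct_mulVec, vecMul_transpose]

theorem aux_dual {q : ℕ} {K : Set (Fin q → ℝ)} {x y : Fin q → ℝ} (hx : x ∈ K)
    (hy : y ∈ dualCone K) : 0 ≤ x ⬝ᵥ y := by
  rw [dotProduct_comm]; exact hy x hx

theorem aux_dual_closed {q : ℕ} (K : Set (Fin q → ℝ)) : IsClosed (dualCone K) := by
  have : dualCone K = ⋂ x ∈ K, {y | 0 ≤ y ⬝ᵥ x} := by ext y; simp [dualCone]
  rw [this]
  refine isClosed_biInter fun x _ => isClosed_le continuous_const ?_
  exact continuous_id.dotProduct continuous_const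

theorem aux_dual_convex {q : ℕ} (K : Set (Fin q → ℝ)) : Convex ℝ (dualCone K) := by
  intro y hy z hz a b ha hb _ x hx
  rw [add_dotProduct, smul_dotProduct, smul_dotProduct]
  have := hy x hx
  have := hz x hx
  simp only [smul_eq_mul]
  positivity

/-- complementarity across two solutions -/
theorem aux_cross {q m r : ℕ} {K : Set (Fin q → ℝ)}
    {A : Matrix (Fin m) (Fin q) ℝ} {M : Matrix (Fin r) (Fin q) ℝ} {b : Fin m → ℝ} {c d : Fin q → ℝ}
    {u u' v v' : Fin r → ℝ} {x x' y y' : Fin q → ℝ} {w w' : Fin m → ℝ}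
    (h : mpKKT K A M b c d u v x w y) (h' : mpKKT K A M b c d u' v' x' w' y')
    (hz : u = u' ∨ v = v') : x ⬝ᵥ y' = 0 ∧ x' ⬝ᵥ y = 0 := by
  obtain ⟨h1, h2, h3, h4, h5, h6⟩ := h
  obtain ⟨h1', h2', h3', h4', h5', h6'⟩ := h'
  have e : ∀ z : Fin q → ℝ, (A *ᵥ z) ⬝ᵥ w + z ⬝ᵥ y = z ⬝ᵥ c + (M *ᵥ z) ⬝ᵥ u := by
    intro z
    rw [← aux_adj, ← aux_adj, ← dotProduct_add, ← dotProduct_add, h4]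
  have e' : ∀ z : Fin q → ℝ, (A *ᵥ z) ⬝ᵥ w' + z ⬝ᵥ y' = z ⬝ᵥ c + (M *ᵥ z) ⬝ᵥ u' := by
    intro z
    rw [← aux_adj, ← aux_adj, ← dotProduct_add, ← dotProduct_add, h4']
  have a1 := e x
  have a2 := e x'
  have a3 := e' x
  have a4 := e' x'
  rw [h1, h2] at a1 a3
  rw [h1', h2'] at a2 a4
  have p1 := aux_dual h3 h5'
  have p2 := aux_dual h3' h5
  rcases hz with rfl | rfl <;> constructor <;> linarith

theorem aux_Phi {q m r : ℕ} (K : Set (Fin q → ℝ)) (hK : ConeAssumptions K)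
    (A : Matrix (Fin m) (Fin q) ℝ) (M : Matrix (Fin r) (Fin q) ℝ)
    (b : Fin m → ℝ) (c d : Fin q → ℝ) (hA2 : Assumption2 K A M b c) (u : Fin r → ℝ) :
    Convex ℝ (Phi K A M b c d u) ∧ IsClosed (Phi K A M b c d u) := by
  rcases (Phi K A M b c d u).eq_empty_or_nonempty with h0 | ⟨v0, x0, w0, y0, h0⟩
  · rw [h0]; exact ⟨convex_empty, isClosed_empty⟩
  have hset : Phi K A M b c d u = {v | ∃ x, (v, x) ∈ {p : (Fin r → ℝ) × (Fin q → ℝ) |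
      A *ᵥ p.2 = b ∧ M *ᵥ p.2 = M *ᵥ d + p.1 ∧ p.2 ∈ K ∧ p.2 ⬝ᵥ y0 = 0}} := by
    ext v
    constructor
    · rintro ⟨x, w, y, h⟩
      exact ⟨x, h.1, h.2.1, h.2.2.1, (aux_cross h h0 (Or.inl rfl)).1⟩
    · rintro ⟨x, h1, h2, h3, h4⟩
      exact ⟨x, w0, y0, h1, h2, h3, h0.2.2.2.1, h0.2.2.2.2.1, h4⟩
  rw [hset]
  constructor
  · rintro v ⟨x, h1, h2, h3, h4⟩ v' ⟨x', h1', h2', h3', h4'⟩ s t hs ht hst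
    dsimp only at h1 h2 h3 h4 h1' h2' h3' h4'
    refine ⟨s • x + t • x', ?_, ?_, hK.2.1 h3 h3' hs ht hst, ?_⟩
    · simp only [mulVec_add, mulVec_smul, h1, h1', ← add_smul, hst, one_smul]
    · simp only [mulVec_add, mulVec_smul, h2, h2']
      rw [smul_add, smul_add, add_add_add_comm, ← add_smul, hst, one_smul]
    · simp [add_dotProduct, smul_dotProduct, h4, h4']
  · obtain ⟨-, w, s, hs⟩ := hA2
    obtain ⟨B, hB⟩ := aux_slater _ _ hs
    refine aux_closed _ ?_ (fun v => B * (b ⬝ᵥ w0 - (M *ᵥ d + v) ⬝ᵥ u - b ⬝ᵥ w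
      - (M *ᵥ d + v) ⬝ᵥ s)) (by fun_prop) ?_
    · refine IsClosed.and ?_ (IsClosed.and ?_ (IsClosed.and ?_ ?_))
      · exact isClosed_eq (by fun_prop) (by fun_prop)
      · exact isClosed_eq (by fun_prop) (by fun_prop)
      · exact hK.1.preimage continuous_snd
      · exact isClosed_eq (by fun_prop) (by fun_prop)
    · rintro v x ⟨h1, h2, h3, h4⟩
      dsimp only at h1 h2 h3 h4
      refine (hB x fun y hy => aux_dual h3 hy).trans (le_of_eq ?_)
      congr 1
      have e : x ⬝ᵥ (Aᵀ *ᵥ w0 + y0) = x ⬝ᵥ (c + Mᵀ *ᵥ u) := by rw [h0.2.2.2.1]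
      simp only [dotProduct_add, dotProduct_sub, aux_adj, h1, h2, h4] at e ⊢
      linarith

theorem aux_Psi {q m r : ℕ} (K : Set (Fin q → ℝ))
    (A : Matrix (Fin m) (Fin q) ℝ) (M : Matrix (Fin r) (Fin q) ℝ)
    (b : Fin m → ℝ) (c d : Fin q → ℝ) (hA2 : Assumption2 K A M b c) (v : Fin r → ℝ) :
    Convex ℝ (Psi K A M b c d v) ∧ IsClosed (Psi K A M b c d v) := by
  rcases (Psi K A M b c d v).eq_empty_or_nonempty with h0 | ⟨u0, x0, w0, y0, h0⟩
  · rw [h0]; exact ⟨convex_empty, isClosed_empty⟩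
  have hset : Psi K A M b c d v = {u | ∃ y, (u, y) ∈ {p : (Fin r → ℝ) × (Fin q → ℝ) |
      c + Mᵀ *ᵥ p.1 - p.2 ∈ LinearMap.range (Matrix.mulVecLin Aᵀ) ∧
        p.2 ∈ dualCone K ∧ x0 ⬝ᵥ p.2 = 0}} := by
    ext u
    constructor
    · rintro ⟨x, w, y, h⟩
      refine ⟨y, ⟨w, ?_⟩, h.2.2.2.2.1, (aux_cross h h0 (Or.inr rfl)).2⟩
      rw [mulVecLin_apply]
      exact eq_sub_of_add_eq h.2.2.2.1
    · rintro ⟨y, ⟨w, h1⟩, h2, h3⟩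
      rw [mulVecLin_apply] at h1
      exact ⟨x0, w, y, h0.1, h0.2.1, h0.2.2.1, eq_sub_iff_add_eq.1 h1, h2, h3⟩
  rw [hset]
  constructor
  · rintro u ⟨y, h1, h2, h3⟩ u' ⟨y', h1', h2', h3'⟩ s t hs ht hst
    dsimp only at h1 h2 h3 h1' h2' h3'
    refine ⟨s • y + t • y', ?_, aux_dual_convex K h2 h2' hs ht hst, ?_⟩
    · have h := Submodule.add_mem _ (Submodule.smul_mem _ s h1) (Submodule.smul_mem _ t h1')
      convert h using 1
      have hc : c = s • c + t • c := by rw [← add_smul, hst, one_smul]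
      simp only [mulVec_add, mulVec_smul]
      nth_rewrite 1 [hc]
      module
    · simp [dotProduct_add, dotProduct_smul, h3, h3']
  · obtain ⟨⟨xb, hxb, hxA⟩, -⟩ := hA2
    obtain ⟨B, hB⟩ := aux_slater _ _ hxb
    refine aux_closed _ ?_ (fun u => B * (xb ⬝ᵥ c + (M *ᵥ xb) ⬝ᵥ u
      - (x0 ⬝ᵥ c + (M *ᵥ x0) ⬝ᵥ u))) (by fun_prop) ?_
    · refine IsClosed.and ?_ (IsClosed.and ?_ ?_)
      · exact (Submodule.closed_of_finiteDimensional
          (LinearMap.range (Matrix.mulVecLin Aᵀ))).preimage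
          (f := fun p : (Fin r → ℝ) × (Fin q → ℝ) => c + Mᵀ *ᵥ p.1 - p.2) (by fun_prop)
      · exact (aux_dual_closed K).preimage continuous_snd
      · exact isClosed_eq (by fun_prop) (by fun_prop)
    · rintro u y ⟨⟨w, h1⟩, h2, h3⟩
      dsimp only at h1 h2 h3
      rw [mulVecLin_apply] at h1
      refine (hB y h2).trans (le_of_eq ?_)
      congr 1
      have e1 : xb ⬝ᵥ (Aᵀ *ᵥ w) = xb ⬝ᵥ (c + Mᵀ *ᵥ u - y) := by rw [h1]
      have e2 : x0 ⬝ᵥ (Aᵀ *ᵥ w) = x0 ⬝ᵥ (c + Mᵀ *ᵥ u - y) := by rw [h1]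
      rw [dotProduct_comm y xb]
      simp only [dotProduct_add, dotProduct_sub, aux_adj, hxA, h0.1, h3] at e1 e2
      linarith

/-- `Φ(u)` and `Ψ(v)` are convex and closed. -/
theorem stmt_6 (hq : 0 < q) (hm : 0 < m) (hr : 0 < r) (hmr : m + r ≤ q)
    (K : Set (Fin q → ℝ)) (hK : ConeAssumptions K)
    (A : Matrix (Fin m) (Fin q) ℝ) (M : Matrix (Fin r) (Fin q) ℝ)
    (b : Fin m → ℝ) (c d : Fin q → ℝ)
    (hA1 : Assumption1 A M) (hA2 : Assumption2 K A M b c) :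
    (∀ u : Fin r → ℝ, Convex ℝ (Phi K A M b c d u) ∧ IsClosed (Phi K A M b c d u)) ∧
    (∀ v : Fin r → ℝ, Convex ℝ (Psi K A M b c d v) ∧ IsClosed (Psi K A M b c d v)) := by
  exact ⟨fun u => aux_Phi K hK A M b c d hA2 u, fun v => aux_Psi K A M b c d hA2 v⟩
end
end

section
/- Under Assumptions 1 and 2, if V is a linearity set of ΘP, then the optimal value function val_P is affine on V: for any u ∈ Ψ(V), one has val_P(v) = inf{⟨c + Mᵀu, x⟩ : x ∈ K, Ax = b} − ⟨u, Md + v⟩ for every v ∈ V; in particular there exist s ∈ ℝ^r and α ∈ ℝ with val_P(v) = ⟨s, v⟩ + α for all v ∈ V. -/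
open Matrix Set Topology Filter

noncomputable section

variable {q m r : ℕ}

theorem kkt_val (K : Set (Fin q → ℝ))
    (A : Matrix (Fin m) (Fin q) ℝ) (M : Matrix (Fin r) (Fin q) ℝ)
    (b : Fin m → ℝ) (c d : Fin q → ℝ) (u v : Fin r → ℝ)
    (hu : u ∈ Psi K A M b c d v) :
    valP K A M b c d v =
        sInf {z | ∃ x ∈ K, A.mulVec x = b ∧ z = (c + Mᵀ.mulVec u) ⬝ᵥ x} -
          u ⬝ᵥ (M.mulVec d + v) := by
  obtain ⟨x, w, y, hAx, hMx, hxK, hst, hy, hxy⟩ := hu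
  have key : ∀ x' : Fin q → ℝ, A.mulVec x' = b →
      (c + Mᵀ.mulVec u) ⬝ᵥ x' = w ⬝ᵥ b + y ⬝ᵥ x' := by
    intro x' h'
    rw [← hst, add_dotProduct, Matrix.mulVec_transpose, ← Matrix.dotProduct_mulVec, h']
  have key2 : ∀ x' : Fin q → ℝ, M.mulVec x' = M.mulVec d + v →
      (c + Mᵀ.mulVec u) ⬝ᵥ x' = c ⬝ᵥ x' + u ⬝ᵥ (M.mulVec d + v) := by
    intro x' h'
    rw [add_dotProduct, Matrix.mulVec_transpose, ← Matrix.dotProduct_mulVec, h']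
  have hyx : y ⬝ᵥ x = 0 := by rw [dotProduct_comm]; exact hxy
  have h1 : IsLeast {z | ∃ x ∈ K, A.mulVec x = b ∧ z = (c + Mᵀ.mulVec u) ⬝ᵥ x} (w ⬝ᵥ b) := by
    refine ⟨⟨x, hxK, hAx, by rw [key x hAx, hyx, add_zero]⟩, ?_⟩
    rintro z ⟨x', hx', hA', rfl⟩
    rw [key x' hA']
    linarith [hy x' hx']
  have h2 : IsLeast {z | ∃ x ∈ K, A.mulVec x = b ∧ M.mulVec x = M.mulVec d + v ∧ z = c ⬝ᵥ x}
      (w ⬝ᵥ b - u ⬝ᵥ (M.mulVec d + v)) := by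
    refine ⟨⟨x, hxK, hAx, hMx, by linarith [key x hAx, key2 x hMx]⟩, ?_⟩
    rintro z ⟨x', hx', hA', hM', rfl⟩
    linarith [hy x' hx', key x' hA', key2 x' hM']
  rw [h1.csInf_eq]
  exact h2.csInf_eq

/-- on a linearity set the primal optimal value function is affine. -/
theorem stmt_7 (hq : 0 < q) (hm : 0 < m) (hr : 0 < r) (hmr : m + r ≤ q)
    (K : Set (Fin q → ℝ)) (hK : ConeAssumptions K)
    (A : Matrix (Fin m) (Fin q) ℝ) (M : Matrix (Fin r) (Fin q) ℝ)
    (b : Fin m → ℝ) (c d : Fin q → ℝ)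
    (hA1 : Assumption1 A M) (hA2 : Assumption2 K A M b c)
    (V : Set (Fin r → ℝ)) (hV : IsLinearitySet K A M b c d V) :
    (∀ v₀ ∈ V, ∀ u ∈ Psi K A M b c d v₀, ∀ v ∈ V,
      valP K A M b c d v =
        sInf {z | ∃ x ∈ K, A.mulVec x = b ∧ z = (c + Mᵀ.mulVec u) ⬝ᵥ x} -
          u ⬝ᵥ (M.mulVec d + v)) ∧
    ∃ (s : Fin r → ℝ) (α : ℝ), ∀ v ∈ V, valP K A M b c d v = s ⬝ᵥ v + α := by
  obtain ⟨-, ⟨v₁, hv₁, -⟩, heq, hne, -, -⟩ := hV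
  have main : ∀ v₀ ∈ V, ∀ u ∈ Psi K A M b c d v₀, ∀ v ∈ V,
      valP K A M b c d v =
        sInf {z | ∃ x ∈ K, A.mulVec x = b ∧ z = (c + Mᵀ.mulVec u) ⬝ᵥ x} -
          u ⬝ᵥ (M.mulVec d + v) := by
    intro v₀ hv₀ u hu v hv
    exact kkt_val K A M b c d u v (heq v₀ hv₀ v hv ▸ hu)
  refine ⟨main, ?_⟩
  obtain ⟨u, hu⟩ := hne v₁ hv₁
  refine ⟨-u, sInf {z | ∃ x ∈ K, A.mulVec x = b ∧ z = (c + Mᵀ.mulVec u) ⬝ᵥ x} -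
    u ⬝ᵥ M.mulVec d, fun v hv => ?_⟩
  rw [main v₁ hv₁ u hu v hv, dotProduct_add, neg_dotProduct]
  ring
end
end

section
/- For all u₁, u₂ ∈ ℝ^r and all v₁ ∈ Φ(u₁), v₂ ∈ Φ(u₂), one has ⟨u₂ − u₁, v₁ − v₂⟩ ≥ 0; that is, the set-valued maps −Φ and −Ψ are monotone on ℝ^r. -/
open Matrix Set Topology Filter

noncomputable section

variable {q m r : ℕ}

/-- monotonicity of `-Φ` (and hence of `-Ψ`). -/
theorem stmt_12 (hq : 0 < q) (hm : 0 < m) (hr : 0 < r) (hmr : m + r ≤ q)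
    (K : Set (Fin q → ℝ)) (hK : ConeAssumptions K)
    (A : Matrix (Fin m) (Fin q) ℝ) (M : Matrix (Fin r) (Fin q) ℝ)
    (b : Fin m → ℝ) (c d : Fin q → ℝ) :
    ∀ u₁ u₂ v₁ v₂ : Fin r → ℝ,
      v₁ ∈ Phi K A M b c d u₁ → v₂ ∈ Phi K A M b c d u₂ →
        0 ≤ (u₂ - u₁) ⬝ᵥ (v₁ - v₂) := by
  rintro u₁ u₂ v₁ v₂ ⟨x₁, w₁, y₁, hA₁, hM₁, hx₁, hE₁, hy₁, hc₁⟩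
    ⟨x₂, w₂, y₂, hA₂, hM₂, hx₂, hE₂, hy₂, hc₂⟩
  have key : ∀ (u v : Fin r → ℝ) (x y : Fin q → ℝ) (w : Fin m → ℝ),
      A.mulVec x = b → M.mulVec x = M.mulVec d + v →
      Aᵀ.mulVec w + y = c + Mᵀ.mulVec u →
      w ⬝ᵥ b + y ⬝ᵥ x = c ⬝ᵥ x + (u ⬝ᵥ M.mulVec d + u ⬝ᵥ v) := by
    intro u v x y w hA hM hE
    have h := congrArg (fun z => z ⬝ᵥ x) hE
    simp only [add_dotProduct, Matrix.mulVec_transpose, ← Matrix.dotProduct_mulVec] at h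
    rw [hA, hM, dotProduct_add] at h
    exact h
  have h11 := key u₁ v₁ x₁ y₁ w₁ hA₁ hM₁ hE₁
  have h12 := key u₁ v₂ x₂ y₁ w₁ hA₂ hM₂ hE₁
  have h21 := key u₂ v₁ x₁ y₂ w₂ hA₁ hM₁ hE₂
  have h22 := key u₂ v₂ x₂ y₂ w₂ hA₂ hM₂ hE₂
  rw [dotProduct_comm] at hc₁ hc₂
  have p := hy₁ x₂ hx₂
  have p' := hy₂ x₁ hx₁
  simp only [sub_dotProduct, dotProduct_sub]
  linarith
end
end

section
/- Under Assumptions 1 and 2, every linearity set V of ΘP is convex, and for every v ∈ cl(V) and every u ∈ Ψ(V), one has v ∈ Φ(u). -/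
open Matrix Set Topology Filter

noncomputable section

variable {q m r : ℕ}

theorem keyId (A : Matrix (Fin m) (Fin q) ℝ) (M : Matrix (Fin r) (Fin q) ℝ)
    (c : Fin q → ℝ) (u : Fin r → ℝ) (x : Fin q → ℝ) (w : Fin m → ℝ) (y : Fin q → ℝ)
    (h : Aᵀ.mulVec w + y = c + Mᵀ.mulVec u) :
    x ⬝ᵥ y = x ⬝ᵥ c + u ⬝ᵥ M.mulVec x - w ⬝ᵥ A.mulVec x := by
  have h1 : x ⬝ᵥ (Aᵀ.mulVec w + y) = x ⬝ᵥ (c + Mᵀ.mulVec u) := by rw [h]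
  have h2 : x ⬝ᵥ Aᵀ.mulVec w = w ⬝ᵥ A.mulVec x := by
    rw [Matrix.mulVec_transpose, dotProduct_comm, Matrix.dotProduct_mulVec]
  have h3 : x ⬝ᵥ Mᵀ.mulVec u = u ⬝ᵥ M.mulVec x := by
    rw [Matrix.mulVec_transpose, dotProduct_comm, Matrix.dotProduct_mulVec]
  rw [dotProduct_add, dotProduct_add, h2, h3] at h1
  linarith

/-- Complementarity holds across solutions with the same `u`. -/
theorem crossComp {K : Set (Fin q → ℝ)} {A : Matrix (Fin m) (Fin q) ℝ}
    {M : Matrix (Fin r) (Fin q) ℝ} {b : Fin m → ℝ} {c d : Fin q → ℝ}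
    {u v₁ v₂ : Fin r → ℝ} {x₁ x₂ : Fin q → ℝ} {w₁ w₂ : Fin m → ℝ} {y₁ y₂ : Fin q → ℝ}
    (h₁ : mpKKT K A M b c d u v₁ x₁ w₁ y₁) (h₂ : mpKKT K A M b c d u v₂ x₂ w₂ y₂) :
    x₂ ⬝ᵥ y₁ = 0 := by
  obtain ⟨a1, a2, a3, a4, a5, a6⟩ := h₁
  obtain ⟨e1, e2, e3, e4, e5, e6⟩ := h₂
  have i1 := keyId A M c u x₁ w₁ y₁ a4
  have i2 := keyId A M c u x₂ w₂ y₂ e4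
  have i3 := keyId A M c u x₂ w₁ y₁ a4
  have i4 := keyId A M c u x₁ w₂ y₂ e4
  have p1 := a5 x₂ e3
  have p2 := e5 x₁ a3
  rw [dotProduct_comm] at p1 p2
  rw [a1] at i1 i4
  rw [e1] at i2 i3
  linarith

theorem psi_segment {K : Set (Fin q → ℝ)} (hK : Convex ℝ K) {A : Matrix (Fin m) (Fin q) ℝ}
    {M : Matrix (Fin r) (Fin q) ℝ} {b : Fin m → ℝ} {c d : Fin q → ℝ}
    {v₁ v₂ v : Fin r → ℝ} (heq : Psi K A M b c d v₁ = Psi K A M b c d v₂)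
    (hne : (Psi K A M b c d v₁).Nonempty) (hv : v ∈ segment ℝ v₁ v₂) :
    Psi K A M b c d v = Psi K A M b c d v₁ := by
  obtain ⟨s, t, hs, ht, hst, rfl⟩ := hv
  have fwd : ∀ u ∈ Psi K A M b c d v₁, ∃ x₁ x₂ w y,
      mpKKT K A M b c d u v₁ x₁ w y ∧ mpKKT K A M b c d u v₂ x₂ w y ∧
      mpKKT K A M b c d u (s • v₁ + t • v₂) (s • x₁ + t • x₂) w y := by
    intro u hu
    have hu2 := hu
    rw [heq] at hu2
    obtain ⟨x₁, w, y, h1⟩ := hu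
    obtain ⟨x₂, w₂, y₂, h2⟩ := hu2
    have hc := crossComp h1 h2
    obtain ⟨a1, a2, a3, a4, a5, a6⟩ := h1
    obtain ⟨e1, e2, e3, e4, e5, e6⟩ := h2
    refine ⟨x₁, x₂, w, y, ⟨a1, a2, a3, a4, a5, a6⟩, ⟨e1, e2, e3, a4, a5, hc⟩, ?_, ?_, ?_, a4, a5, ?_⟩
    · rw [Matrix.mulVec_add, Matrix.mulVec_smul, Matrix.mulVec_smul, a1, e1, ← add_smul, hst, one_smul]
    · rw [Matrix.mulVec_add, Matrix.mulVec_smul, Matrix.mulVec_smul, a2, e2]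
      have : M.mulVec d = (s + t) • M.mulVec d := by rw [hst, one_smul]
      rw [smul_add, smul_add, add_add_add_comm, ← add_smul, ← this]
    · exact hK a3 e3 hs ht hst
    · rw [add_dotProduct, smul_dotProduct, smul_dotProduct, a6, hc]; simp
  apply Set.Subset.antisymm
  · rintro u ⟨x, w, y, h⟩
    obtain ⟨u₀, hu₀⟩ := hne
    obtain ⟨x₁, x₂, w₀, y₀, h1, h2, h3⟩ := fwd u₀ hu₀
    obtain ⟨a1, a2, a3, a4, a5, a6⟩ := h
    obtain ⟨f1, f2, f3, f4, f5, f6⟩ := h3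
    have i1 := keyId A M c u x w y a4
    have i2 := keyId A M c u (s • x₁ + t • x₂) w y a4
    have i3 := keyId A M c u₀ x w₀ y₀ f4
    have i4 := keyId A M c u₀ (s • x₁ + t • x₂) w₀ y₀ f4
    rw [a1, a2] at i1 i3
    rw [f1, f2] at i2 i4
    have p1 := f5 x a3
    rw [dotProduct_comm] at p1
    have hle : (s • x₁ + t • x₂) ⬝ᵥ y ≤ 0 := by linarith
    rw [add_dotProduct, smul_dotProduct, smul_dotProduct, smul_eq_mul, smul_eq_mul] at hle
    have q1 := a5 x₁ h1.2.2.1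
    have q2 := a5 x₂ h2.2.2.1
    rw [dotProduct_comm] at q1 q2
    have m1 := mul_nonneg hs q1
    have m2 := mul_nonneg ht q2
    rcases hs.eq_or_lt with h0 | h0
    · have ht1 : t = 1 := by linarith
      rw [heq]
      refine ⟨x₂, w, y, h2.1, h2.2.1, h2.2.2.1, a4, a5, ?_⟩
      subst ht1
      linarith
    · refine ⟨x₁, w, y, h1.1, h1.2.1, h1.2.2.1, a4, a5, ?_⟩
      have : s * (x₁ ⬝ᵥ y) = 0 := by linarith
      exact (mul_eq_zero.1 this).resolve_left h0.ne'
  · intro u hu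
    obtain ⟨x₁, x₂, w, y, -, -, h⟩ := fwd u hu
    exact ⟨_, w, y, h⟩

theorem bound_of_interior {K : Set (Fin q → ℝ)} {e : Fin q → ℝ}
    (he : e ∈ interior (dualCone K)) :
    ∃ ε > 0, ∀ x ∈ K, ∀ i, ε * |x i| ≤ x ⬝ᵥ e := by
  obtain ⟨ε, hε, hb⟩ := Metric.nhds_basis_closedBall.mem_iff.1 (mem_interior_iff_mem_nhds.1 he)
  refine ⟨ε, hε, fun x hx i => ?_⟩
  have key : ∀ z : ℝ, |z| ≤ ε → 0 ≤ x ⬝ᵥ e + z * x i := by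
    intro z hz
    have : e + Pi.single i z ∈ dualCone K := by
      apply hb
      rw [mem_closedBall_iff_norm, add_sub_cancel_left, Pi.norm_single]
      simpa using hz
    have h := this x hx
    rwa [add_dotProduct, single_dotProduct, dotProduct_comm] at h
  have k1 := key ε (abs_of_pos hε).le
  have k2 := key (-ε) (by rw [abs_neg, abs_of_pos hε])
  rcases abs_cases (x i) with ⟨h, _⟩ | ⟨h, _⟩ <;> rw [h] <;> linarith

/-- every linearity set of `ΘP` is convex, and every point of its closure
belongs to `Φ(u)` for every `u ∈ Ψ(V)`. -/
theorem stmt_16 (hq : 0 < q) (hm : 0 < m) (hr : 0 < r) (hmr : m + r ≤ q)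
    (K : Set (Fin q → ℝ)) (hK : ConeAssumptions K)
    (A : Matrix (Fin m) (Fin q) ℝ) (M : Matrix (Fin r) (Fin q) ℝ)
    (b : Fin m → ℝ) (c d : Fin q → ℝ)
    (hA1 : Assumption1 A M) (hA2 : Assumption2 K A M b c)
    (V : Set (Fin r → ℝ)) (hV : IsLinearitySet K A M b c d V) :
    Convex ℝ V ∧
      ∀ v ∈ closure V, ∀ v₀ ∈ V, ∀ u ∈ Psi K A M b c d v₀,
        v ∈ Phi K A M b c d u := by
  obtain ⟨hVT, hVp, hVe, hVn, -, hVm⟩ := hV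
  obtain ⟨hKc, hKx, -⟩ := hK
  constructor
  · rw [convex_iff_segment_subset]
    intro v₁ h₁ v₂ h₂
    by_contra hns
    have hps : ∀ v ∈ segment ℝ v₁ v₂, Psi K A M b c d v = Psi K A M b c d v₁ :=
      fun v hv => psi_segment hKx (hVe _ h₁ _ h₂) (hVn _ h₁) hv
    have hall : ∀ v ∈ V ∪ segment ℝ v₁ v₂, Psi K A M b c d v = Psi K A M b c d v₁ := by
      rintro v (hv | hv)
      · exact hVe _ hv _ h₁
      · exact hps v hv
    have hnem : ∀ v ∈ V ∪ segment ℝ v₁ v₂, (Psi K A M b c d v).Nonempty := by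
      intro v hv
      rw [hall v hv]
      exact hVn _ h₁
    refine hVm (V ∪ segment ℝ v₁ v₂) ?_ ?_ ?_ ⟨fun a ha a' ha' => by rw [hall a ha, hall a' ha'], hnem⟩
    · intro v hv
      obtain ⟨u, x, w, y, h⟩ := hnem v hv
      exact ⟨x, h.2.2.1, h.1, h.2.1⟩
    · exact hVp.union ((convex_segment v₁ v₂).isPathConnected ⟨v₁, left_mem_segment ℝ _ _⟩)
        ⟨v₁, h₁, left_mem_segment ℝ _ _⟩
    · exact ⟨Set.subset_union_left, fun h => hns (Set.subset_union_right.trans h)⟩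
  · intro v hv v₀ hv₀ u hu
    obtain ⟨-, w', s', he⟩ := hA2
    obtain ⟨ε, hε, hbd⟩ := bound_of_interior he
    obtain ⟨x₀, w, y, h0⟩ := id hu
    have hsol : ∀ v' ∈ V, ∃ x, mpKKT K A M b c d u v' x w y := by
      intro v' hv'
      have hu' : u ∈ Psi K A M b c d v' := by rw [hVe _ hv' _ hv₀]; exact hu
      obtain ⟨x, w₂, y₂, h⟩ := hu'
      exact ⟨x, h.1, h.2.1, h.2.2.1, h0.2.2.2.1, h0.2.2.2.2.1, crossComp h0 h⟩
    set g : (Fin r → ℝ) → ℝ := fun v' =>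
      w ⬝ᵥ b - w' ⬝ᵥ b - u ⬝ᵥ (M.mulVec d + v') - s' ⬝ᵥ (M.mulVec d + v') with hg
    have hgc : Continuous g := by
      simp only [hg, dotProduct, Pi.add_apply]
      fun_prop
    set R : ℝ := (g v + 1) / ε with hR
    let S : Set (Fin q → ℝ) := Set.Icc (fun _ => -R) (fun _ => R) ∩
      (K ∩ ({x | A.mulVec x = b} ∩ {x | x ⬝ᵥ y = 0}))
    have hS : IsCompact S := by
      refine isCompact_Icc.inter_right (hKc.inter (IsClosed.inter ?_ ?_))
      · exact isClosed_eq (Continuous.matrix_mulVec continuous_const continuous_id) continuous_const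
      · exact isClosed_eq (Continuous.dotProduct continuous_id continuous_const) continuous_const
    have hT : IsClosed ((fun x => M.mulVec x - M.mulVec d) '' S) := by
      refine (hS.image ?_).isClosed
      exact (Continuous.matrix_mulVec continuous_const continuous_id).sub continuous_const
    have hmem : v ∈ (fun x => M.mulVec x - M.mulVec d) '' S := by
      by_contra hn
      have hO : IsOpen (((fun x => M.mulVec x - M.mulVec d) '' S)ᶜ ∩ {v' | g v' < g v + 1}) :=
        hT.isOpen_compl.inter (isOpen_lt hgc continuous_const)
      obtain ⟨v', ⟨hn', hlt⟩, hv'⟩ := mem_closure_iff.1 hv _ hO ⟨hn, by simp⟩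
      apply hn'
      obtain ⟨x, h1, h2, h3, h4, h5, h6⟩ := hsol v' hv'
      have hxe : x ⬝ᵥ (c - Aᵀ.mulVec w' - Mᵀ.mulVec s') = g v' := by
        have i1 := keyId A M c u x w y h4
        have i2 := keyId A M c (-s') x w' (c - Aᵀ.mulVec w' - Mᵀ.mulVec s')
          (by rw [Matrix.mulVec_neg]; abel)
        rw [h1, h2] at i1 i2
        rw [neg_dotProduct] at i2
        simp only [hg]
        linarith
      have hxi : ∀ i, |x i| ≤ R := by
        intro i
        have := hbd x h3 i
        rw [hxe] at this
        have hlt' : g v' < g v + 1 := hlt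
        rw [hR, le_div_iff₀ hε]
        linarith
      exact ⟨x, ⟨⟨fun i => (abs_le.1 (hxi i)).1, fun i => (abs_le.1 (hxi i)).2⟩, h3, h1, h6⟩,
        by simp [h2]⟩
    obtain ⟨x, ⟨-, h3, h1, h6⟩, hx⟩ := hmem
    refine ⟨x, w, y, h1, ?_, h3, h0.2.2.2.1, h0.2.2.2.2.1, h6⟩
    rw [← hx]
    simp
end
end

section
/- Under Assumptions 1 and 2, if K is semialgebraic, then the feasible set 𝒳 = {x ∈ K : Ax = b} has only finitely many vertices; here a point x̄ ∈ 𝒳 is called a vertex of 𝒳 if its normal cone Normal(𝒳, x̄) = {c' ∈ ℝ^q : ⟨c', x̄⟩ ≥ ⟨c', x⟩ for all x ∈ 𝒳} has nonempty interior in ℝ^q. -/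
open Matrix Set Topology Filter

noncomputable section

variable {q m r : ℕ}

def polyZero (I : Ideal (MvPolynomial (Fin q) ℝ)) : Set (Fin q → ℝ) :=
  {x | ∀ p ∈ I, MvPolynomial.eval x p = 0}

/-- Local vertices of a set. -/
def locVert (Z : Set (Fin q → ℝ)) : Set (Fin q → ℝ) :=
  {x | x ∈ Z ∧ (interior {c : Fin q → ℝ | ∀ᶠ y in 𝓝 x, y ∈ Z → c ⬝ᵥ y ≤ c ⬝ᵥ x}).Nonempty}

lemma locVert_anti {Z Z' : Set (Fin q → ℝ)} (h : Z' ⊆ Z) {x : Fin q → ℝ}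
    (hx : x ∈ locVert Z) (hx' : x ∈ Z') : x ∈ locVert Z' := by
  refine ⟨hx', hx.2.mono (interior_mono ?_)⟩
  intro c hc
  exact hc.mono fun y hy hyZ => hy (h hyZ)

lemma polyZero_anti {I J : Ideal (MvPolynomial (Fin q) ℝ)} (h : I ≤ J) :
    polyZero J ⊆ polyZero I := fun _ hx p hp => hx p (h hp)

lemma mem_polyZero_sup {I : Ideal (MvPolynomial (Fin q) ℝ)} {a : MvPolynomial (Fin q) ℝ}
    {x : Fin q → ℝ} (hx : x ∈ polyZero I) (ha : MvPolynomial.eval x a = 0) :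
    x ∈ polyZero (I ⊔ Ideal.span {a}) := by
  have : I ⊔ Ideal.span {a} ≤ RingHom.ker (MvPolynomial.eval x) := by
    refine sup_le (fun p hp => hx p hp) ?_
    rw [Ideal.span_le]
    intro p hp
    rw [Set.mem_singleton_iff] at hp
    subst hp
    exact ha
  exact fun p hp => this hp

lemma hasDerivAt_evalpoly (a : Fin q → MvPolynomial (Fin q) ℝ) (γ : ℝ → Fin q → ℝ) (t : ℝ)
    (h : HasDerivAt γ (fun i => MvPolynomial.eval (γ t) (a i)) t) (p : MvPolynomial (Fin q) ℝ) :
    HasDerivAt (fun s => MvPolynomial.eval (γ s) p)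
      (MvPolynomial.eval (γ t) (MvPolynomial.mkDerivation ℝ a p)) t := by
  induction p using MvPolynomial.induction_on with
  | C r => simpa using hasDerivAt_const t r
  | add p p' hp hp' =>
    simp only [map_add]
    exact hp.fun_add hp'
  | mul_X p i hp =>
    have h2 := (hasDerivAt_pi.1 h) i
    have h3 := hp.fun_mul h2
    simp only [map_mul, MvPolynomial.eval_X, Derivation.leibniz, MvPolynomial.mkDerivation_X,
      map_add, smul_eq_mul]
    refine h3.congr_deriv ?_
    ring

lemma contDiff_evalpoly (p : MvPolynomial (Fin q) ℝ) :
    ContDiff ℝ 1 (fun x : Fin q → ℝ => MvPolynomial.eval x p) := by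
  induction p using MvPolynomial.induction_on with
  | C r => simpa using contDiff_const
  | add p p' hp hp' => simpa using hp.add hp'
  | mul_X p i hp => simpa using hp.mul (contDiff_apply ℝ ℝ i)

lemma flow_lemma (a : Fin q → MvPolynomial (Fin q) ℝ) (I : Ideal (MvPolynomial (Fin q) ℝ))
    (hD : ∀ p ∈ I, MvPolynomial.mkDerivation ℝ a p ∈ I) (x : Fin q → ℝ) (hx : x ∈ polyZero I)
    (c : Fin q → ℝ) (hc : ∀ᶠ y in 𝓝 x, y ∈ polyZero I → c ⬝ᵥ y ≤ c ⬝ᵥ x) :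
    c ⬝ᵥ (fun i => MvPolynomial.eval x (a i)) ≤ 0 := by
  have hcd : ContDiffAt ℝ 1 (fun y : Fin q → ℝ => fun i => MvPolynomial.eval y (a i)) x :=
    (contDiff_pi.2 fun i => contDiff_evalpoly (a i)).contDiffAt
  obtain ⟨γ, h0, ε, hε, hγ⟩ :=
    hcd.exists_forall_mem_closedBall_exists_eq_forall_mem_Ioo_hasDerivAt₀ 0
  obtain ⟨k, f, hf⟩ := Submodule.fg_iff_exists_fin_generating_family.1
    (IsNoetherian.noetherian I)
  have hfI : ∀ i, f i ∈ I := fun i => hf ▸ Submodule.subset_span ⟨i, rfl⟩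
  have hB : ∀ i, ∃ B : Fin k → MvPolynomial (Fin q) ℝ,
      ∑ j, B j • f j = MvPolynomial.mkDerivation ℝ a (f i) := by
    intro i
    have := hD _ (hfI i)
    rw [← hf] at this
    exact (Submodule.mem_span_range_iff_exists_fun _).1 this
  choose B hB using hB
  have hsub : ∀ t ∈ Icc (0:ℝ) (ε/2), t ∈ Ioo (0 - ε) (0 + ε) := by
    intro t ht
    constructor <;> linarith [ht.1, ht.2]
  have hγc : ContinuousOn γ (Icc 0 (ε/2)) := fun t ht =>
    (hγ t (hsub t ht)).continuousAt.continuousWithinAt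
  have hbd : ∃ C, ∀ t ∈ Icc (0:ℝ) (ε/2),
      ‖∑ i, ∑ j, |MvPolynomial.eval (γ t) (B i j)|‖ ≤ C := by
    apply isCompact_Icc.exists_bound_of_continuousOn
    refine continuousOn_finsetSum _ fun i _ => continuousOn_finsetSum _ fun j _ => ?_
    exact ((contDiff_evalpoly (B i j)).continuous.comp_continuousOn hγc).abs
  obtain ⟨C, hC⟩ := hbd
  have hu : ∀ t ∈ Icc (0:ℝ) (ε/2), HasDerivAt (fun s => fun i => MvPolynomial.eval (γ s) (f i))
      (fun i => ∑ j, MvPolynomial.eval (γ t) (B i j) * MvPolynomial.eval (γ t) (f j)) t := by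
    intro t ht
    rw [hasDerivAt_pi]
    intro i
    have := hasDerivAt_evalpoly a γ t (hγ t (hsub t ht)) (f i)
    rw [← hB i] at this
    simpa using this
  have hzero : ∀ t ∈ Icc (0:ℝ) (ε/2), (fun i => MvPolynomial.eval (γ t) (f i)) = 0 := by
    have key := norm_le_gronwallBound_of_norm_deriv_right_le (E := Fin k → ℝ)
      (f := fun s => fun i => MvPolynomial.eval (γ s) (f i))
      (f' := fun t => fun i => ∑ j, MvPolynomial.eval (γ t) (B i j) * MvPolynomial.eval (γ t) (f j))
      (δ := 0) (K := C) (ε := 0) (a := 0) (b := ε/2)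
      (fun t ht => (hu t ht).continuousAt.continuousWithinAt)
      (fun t ht => (hu t (Ico_subset_Icc_self ht)).hasDerivWithinAt)
      (by
        simp only [h0, norm_le_zero_iff]
        funext i
        exact hx _ (hfI i))
      (by
        intro t ht
        have h1 := hC t (Ico_subset_Icc_self ht)
        rw [Real.norm_of_nonneg (by positivity)] at h1
        have hC0 : 0 ≤ C := le_trans (by positivity) h1
        rw [add_zero]
        refine (pi_norm_le_iff_of_nonneg (by positivity)).2 fun i => ?_
        calc ‖∑ j, MvPolynomial.eval (γ t) (B i j) * MvPolynomial.eval (γ t) (f j)‖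
            ≤ ∑ j, ‖MvPolynomial.eval (γ t) (B i j) * MvPolynomial.eval (γ t) (f j)‖ :=
              norm_sum_le _ _
          _ ≤ ∑ j, |MvPolynomial.eval (γ t) (B i j)| *
                ‖fun i => MvPolynomial.eval (γ t) (f i)‖ := by
              refine Finset.sum_le_sum fun j _ => ?_
              rw [norm_mul, Real.norm_eq_abs]
              exact mul_le_mul_of_nonneg_left
                (norm_le_pi_norm (fun i => MvPolynomial.eval (γ t) (f i)) j) (abs_nonneg _)
          _ = (∑ j, |MvPolynomial.eval (γ t) (B i j)|) *
                ‖fun i => MvPolynomial.eval (γ t) (f i)‖ := by rw [Finset.sum_mul]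
          _ ≤ _ := by
              refine mul_le_mul_of_nonneg_right (le_trans ?_ h1) (norm_nonneg _)
              exact Finset.single_le_sum
                (f := fun i => ∑ j, |MvPolynomial.eval (γ t) (B i j)|)
                (fun i _ => by positivity) (Finset.mem_univ i))
    intro t ht
    have := key t ht
    simpa [gronwallBound_ε0] using this
  have hmem : ∀ t ∈ Icc (0:ℝ) (ε/2), γ t ∈ polyZero I := by
    intro t ht
    have : I ≤ RingHom.ker (MvPolynomial.eval (γ t)) := by
      rw [← hf, Submodule.span_le]
      rintro _ ⟨i, rfl⟩
      exact congrFun (hzero t ht) i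
    exact fun p hp => this hp
  have hγ0 := hγ 0 (hsub 0 ⟨le_rfl, by positivity⟩)
  rw [h0] at hγ0
  have hg : HasDerivAt (fun t => c ⬝ᵥ γ t) (c ⬝ᵥ (fun i => MvPolynomial.eval x (a i))) 0 := by
    have h1 := hasDerivAt_pi.1 hγ0
    simp only [dotProduct]
    exact HasDerivAt.fun_sum fun i _ => (h1 i).const_mul (c i)
  have hev : ∀ᶠ t in 𝓝[>] (0:ℝ), t⁻¹ • ((c ⬝ᵥ γ (0 + t)) - c ⬝ᵥ γ 0) ≤ 0 := by
    have h1 : ∀ᶠ t in 𝓝 (0:ℝ), γ t ∈ polyZero I → c ⬝ᵥ γ t ≤ c ⬝ᵥ x := by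
      have : Tendsto γ (𝓝 0) (𝓝 x) := by
        have := hγ0.continuousAt.tendsto
        rwa [h0] at this
      exact this.eventually hc
    have h2 : ∀ᶠ t in 𝓝[>] (0:ℝ), t ∈ Ioo (0:ℝ) (ε/2) := Ioo_mem_nhdsGT (by positivity)
    filter_upwards [h2, nhdsWithin_le_nhds h1] with t ht h
    have := h (hmem t (Ioo_subset_Icc_self ht))
    rw [zero_add, h0, smul_eq_mul]
    exact mul_nonpos_of_nonneg_of_nonpos (inv_nonneg.2 ht.1.le) (by linarith)
  exact le_of_tendsto (hg.tendsto_slope_zero_right) hev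

lemma derivation_ne_zero (L : Type) [Field L] [Algebra ℝ L] [Algebra.EssFiniteType ℝ L]
    (h : ¬ Algebra.IsAlgebraic ℝ L) : ∃ d : Derivation ℝ L L, d ≠ 0 := by
  have h1 : ¬ Algebra.FormallyUnramified ℝ L := by
    rw [Algebra.FormallyUnramified.iff_isSeparable]
    intro hs
    exact h inferInstance
  have h2 : ¬ Subsingleton (KaehlerDifferential ℝ L) := fun hs => h1 ⟨hs⟩
  rw [not_subsingleton_iff_nontrivial] at h2
  obtain ⟨v, hv⟩ := exists_ne (0 : KaehlerDifferential ℝ L)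
  by_contra hcon
  push Not at hcon
  apply hv
  rw [← Module.forall_dual_apply_eq_zero_iff L]
  intro φ
  have h3 := hcon ((KaehlerDifferential.linearMapEquivDerivation ℝ L) φ)
  rw [LinearEquiv.map_eq_zero_iff] at h3
  rw [h3]
  rfl

lemma exists_vf (P : Ideal (MvPolynomial (Fin q) ℝ)) [P.IsPrime]
    (h : ¬ Algebra.IsAlgebraic ℝ (MvPolynomial (Fin q) ℝ ⧸ P)) :
    ∃ a : Fin q → MvPolynomial (Fin q) ℝ,
      (∀ p ∈ P, MvPolynomial.mkDerivation ℝ a p ∈ P) ∧ ∃ i, a i ∉ P := by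
  set A := MvPolynomial (Fin q) ℝ ⧸ P with hA
  let L := FractionRing A
  have hL : ¬ Algebra.IsAlgebraic ℝ L := by
    intro hL
    refine h ⟨fun x => ?_⟩
    have := hL.isAlgebraic (algebraMap A L x)
    exact (isAlgebraic_algebraMap_iff (IsFractionRing.injective A L)).1 this
  obtain ⟨d, hd⟩ := derivation_ne_zero L hL
  obtain ⟨s, hs⟩ := IsLocalization.exist_integer_multiples_of_finite (nonZeroDivisors A)
    (fun i : Fin q => d (algebraMap A L (Ideal.Quotient.mk P (MvPolynomial.X i))))
  choose w hw using hs
  choose a ha using fun i => Ideal.Quotient.mk_surjective (w i)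
  have hs0 : algebraMap A L (s : A) ≠ 0 :=
    IsFractionRing.to_map_ne_zero_of_mem_nonZeroDivisors s.2
  have key : ∀ p, algebraMap A L (Ideal.Quotient.mk P (MvPolynomial.mkDerivation ℝ a p)) =
      algebraMap A L (s : A) * d (algebraMap A L (Ideal.Quotient.mk P p)) := by
    intro p
    induction p using MvPolynomial.induction_on with
    | C r =>
      have : algebraMap A L (Ideal.Quotient.mk P (MvPolynomial.C r)) = algebraMap ℝ L r := rfl
      rw [this]
      simp
    | add p p' hp hp' =>
      simp only [map_add, hp, hp', mul_add]
    | mul_X p i hp =>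
      have h1 := hw i
      rw [Algebra.smul_def] at h1
      simp only [map_mul, map_add, Derivation.leibniz, MvPolynomial.mkDerivation_X, smul_eq_mul,
        hp, ha, h1]
      ring
  have hinj : ∀ p, algebraMap A L (Ideal.Quotient.mk P p) = 0 → p ∈ P := by
    intro p hp
    rw [← Ideal.Quotient.eq_zero_iff_mem]
    exact IsFractionRing.injective A L (by rw [hp, map_zero])
  refine ⟨a, fun p hp => ?_, ?_⟩
  · apply hinj
    rw [key, Ideal.Quotient.eq_zero_iff_mem.2 hp]
    simp
  · by_contra hcon
    push Not at hcon
    have hz : ∀ p, MvPolynomial.mkDerivation ℝ a p ∈ P := by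
      intro p
      induction p using MvPolynomial.induction_on with
      | C r => simp
      | add p p' hp hp' => simpa using P.add_mem hp hp'
      | mul_X p i hp =>
        simp only [Derivation.leibniz, MvPolynomial.mkDerivation_X, smul_eq_mul]
        exact P.add_mem (P.mul_mem_left _ (hcon i)) (P.mul_mem_left _ hp)
    have hdA : ∀ y : A, d (algebraMap A L y) = 0 := by
      intro y
      obtain ⟨p, rfl⟩ := Ideal.Quotient.mk_surjective y
      have := key p
      rw [Ideal.Quotient.eq_zero_iff_mem.2 (hz p), map_zero] at this
      exact (mul_eq_zero.1 this.symm).resolve_left hs0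
    apply hd
    ext z
    obtain ⟨x, y, hy, rfl⟩ := IsFractionRing.div_surjective (A := A) z
    have hy0 := IsFractionRing.to_map_ne_zero_of_mem_nonZeroDivisors (K := L) hy
    have h1 : d (algebraMap A L y * (algebraMap A L x / algebraMap A L y)) = 0 := by
      rw [mul_div_cancel₀ _ hy0]
      exact hdA x
    rw [Derivation.leibniz, hdA y] at h1
    simpa [hy0] using h1

lemma polyZero_finite (P : Ideal (MvPolynomial (Fin q) ℝ))
    (h : Algebra.IsAlgebraic ℝ (MvPolynomial (Fin q) ℝ ⧸ P)) : (polyZero P).Finite := by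
  have h1 : ∀ i : Fin q, ∃ p : Polynomial ℝ, p ≠ 0 ∧
      Polynomial.aeval (Ideal.Quotient.mk P (MvPolynomial.X i)) p = 0 := fun i =>
    h.isAlgebraic (Ideal.Quotient.mk P (MvPolynomial.X i))
  choose p hp0 hp using h1
  refine (Set.Finite.pi' (fun i => (p i).rootSet_finite ℝ)).subset ?_
  intro x hx i
  rw [Polynomial.mem_rootSet]
  refine ⟨hp0 i, ?_⟩
  have h2 : Polynomial.aeval (MvPolynomial.X i : MvPolynomial (Fin q) ℝ) (p i) ∈ P := by
    rw [← Ideal.Quotient.eq_zero_iff_mem]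
    have := hp i
    rw [← Ideal.Quotient.mkₐ_eq_mk ℝ, Polynomial.aeval_algHom_apply] at this
    simpa using this
  have h3 := hx _ h2
  have h4 := Polynomial.aeval_algHom_apply (MvPolynomial.aeval (R := ℝ) x)
    (MvPolynomial.X i : MvPolynomial (Fin q) ℝ) (p i)
  rw [MvPolynomial.aeval_X] at h4
  rw [h4, ← h3]
  rfl

lemma locVert_finite (I : Ideal (MvPolynomial (Fin q) ℝ)) : (locVert (polyZero I)).Finite := by
  induction I using WellFoundedGT.induction with
  | ind I ih =>
  have hlt : ∀ a, a ∉ I → I < I ⊔ Ideal.span {a} := by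
    intro a ha
    refine lt_of_le_of_ne le_sup_left fun h => ha ?_
    rw [h]
    exact Ideal.mem_sup_right (Ideal.mem_span_singleton_self a)
  by_cases hP : I.IsPrime
  · by_cases halg : Algebra.IsAlgebraic ℝ (MvPolynomial (Fin q) ℝ ⧸ I)
    · exact (polyZero_finite I halg).subset fun x hx => hx.1
    · obtain ⟨a, haI, i, hi⟩ := exists_vf I halg
      refine (ih _ (hlt _ hi)).subset ?_
      intro x hx
      refine locVert_anti (polyZero_anti le_sup_left) hx (mem_polyZero_sup hx.1 ?_)
      obtain ⟨c, hc⟩ := hx.2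
      have hneg : ∀ p, MvPolynomial.mkDerivation ℝ (-a) p = - MvPolynomial.mkDerivation ℝ a p := by
        intro p
        have : MvPolynomial.mkDerivation ℝ (-a) = - MvPolynomial.mkDerivation ℝ a := by
          apply MvPolynomial.derivation_ext
          intro i
          simp
        rw [this]; rfl
      have hz : ∀ c ∈ interior {c : Fin q → ℝ | ∀ᶠ y in 𝓝 x, y ∈ polyZero I → c ⬝ᵥ y ≤ c ⬝ᵥ x},
          c ⬝ᵥ (fun i => MvPolynomial.eval x (a i)) = 0 := by
        intro c hc
        have hc := interior_subset hc
        have h1 := flow_lemma a I haI x hx.1 c hc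
        have h2 := flow_lemma (-a) I (fun p hp => by
          rw [hneg]; exact I.neg_mem (haI p hp)) x hx.1 c hc
        have h3 : (fun i => MvPolynomial.eval x ((-a) i)) =
            -(fun i => MvPolynomial.eval x (a i)) := by
          funext i; simp
        rw [h3, dotProduct_neg] at h2
        linarith
      have hcont : Tendsto (fun t : ℝ => c + t • (Pi.single i 1 : Fin q → ℝ)) (𝓝 0) (𝓝 c) := by
        have : Continuous (fun t : ℝ => c + t • (Pi.single i 1 : Fin q → ℝ)) := by fun_prop
        simpa using this.tendsto 0
      have hev := (hcont.eventually (isOpen_interior.mem_nhds hc)).filter_mono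
        (nhdsWithin_le_nhds (s := Ioi 0))
      obtain ⟨t, ht, ht0⟩ := (hev.and self_mem_nhdsWithin).exists
      have h1 := hz _ ht
      have ht0 : (0:ℝ) < t := ht0
      rw [add_dotProduct, hz c hc, smul_dotProduct, single_one_dotProduct] at h1
      simpa [ht0.ne'] using h1
  · rw [Ideal.isPrime_iff] at hP
    by_cases htop : I = ⊤
    · convert Set.finite_empty
      ext x
      simp only [Set.mem_empty_iff_false, iff_false]
      intro hx
      have := hx.1 1 (by rw [htop]; trivial)
      simp at this
    · push Not at hP
      obtain ⟨a, b, hab, ha, hb⟩ := hP htop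
      refine ((ih _ (hlt _ ha)).union (ih _ (hlt _ hb))).subset ?_
      intro x hx
      have := hx.1 _ hab
      rw [map_mul, mul_eq_zero] at this
      rcases this with h | h
      · exact Or.inl (locVert_anti (polyZero_anti le_sup_left) hx (mem_polyZero_sup hx.1 h))
      · exact Or.inr (locVert_anti (polyZero_anti le_sup_left) hx (mem_polyZero_sup hx.1 h))

/-- the feasible set `𝒳 = {x ∈ K : Ax = b}` has finitely many vertices. -/
theorem stmt_18 (hq : 0 < q) (hm : 0 < m) (hr : 0 < r) (hmr : m + r ≤ q)
    (K : Set (Fin q → ℝ)) (hK : ConeAssumptions K) (hKsa : IsSemialgebraic K)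
    (A : Matrix (Fin m) (Fin q) ℝ) (M : Matrix (Fin r) (Fin q) ℝ)
    (b : Fin m → ℝ) (c d : Fin q → ℝ)
    (hA1 : Assumption1 A M) (hA2 : Assumption2 K A M b c) :
    Set.Finite {xbar : Fin q → ℝ |
      (xbar ∈ K ∧ A.mulVec xbar = b) ∧
      (interior {c' : Fin q → ℝ |
        ∀ x ∈ K, A.mulVec x = b → c' ⬝ᵥ x ≤ c' ⬝ᵥ xbar}).Nonempty} := by
  obtain ⟨N, T, hT, hKT⟩ := hKsa
  choose k l f g hfg using hT
  let e : Fin m → MvPolynomial (Fin q) ℝ := fun j =>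
    (∑ i, MvPolynomial.C (A j i) * MvPolynomial.X i) - MvPolynomial.C (b j)
  have he : ∀ j (x : Fin q → ℝ), MvPolynomial.eval x (e j) = A.mulVec x j - b j := by
    intro j x
    simp [e, Matrix.mulVec, dotProduct]
  let I : Fin N → Ideal (MvPolynomial (Fin q) ℝ) := fun i =>
    Ideal.span (Set.range (f i) ∪ Set.range e)
  refine (Set.finite_iUnion fun i => locVert_finite (I i)).subset ?_
  rintro x ⟨⟨hxK, hxb⟩, hint⟩
  rw [hKT, Set.mem_iUnion] at hxK
  obtain ⟨i, hxi⟩ := hxK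
  rw [Set.mem_iUnion]
  have hxi' := hxi
  rw [hfg i] at hxi'
  refine ⟨i, ?_, hint.mono (interior_mono ?_)⟩
  · have : I i ≤ RingHom.ker (MvPolynomial.eval x) := by
      rw [Ideal.span_le]
      rintro p (⟨j, rfl⟩ | ⟨j, rfl⟩)
      · exact hxi'.1 j
      · change MvPolynomial.eval x (e j) = 0
        rw [he, hxb, sub_self]
    exact fun p hp => this hp
  · intro c' hc'
    have hpos : ∀ᶠ y in 𝓝 x, ∀ j, 0 < MvPolynomial.eval y (g i j) := by
      rw [Filter.eventually_all]
      intro j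
      exact (contDiff_evalpoly (g i j)).continuous.continuousAt.eventually
        (lt_mem_nhds (hxi'.2 j))
    filter_upwards [hpos] with y hy hyZ
    refine hc' y ?_ ?_
    · rw [hKT, Set.mem_iUnion]
      refine ⟨i, ?_⟩
      rw [hfg i]
      exact ⟨fun j => hyZ _ (Ideal.subset_span (Or.inl ⟨j, rfl⟩)), hy⟩
    · funext j
      have := hyZ _ (Ideal.subset_span (Or.inr ⟨j, rfl⟩))
      rw [he] at this
      linarith
end
end
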